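/- There exists a constant K > 0, independent of G, such that for every G ≥ 1 and all v, ξ ∈ ℝ, the perturbing potential evaluated along the unperturbed homoclinic satisfies |U(r_h(v), ξ)| ≤ K·G^{−4}·(1 + v²)^{−1}. -/

import Mathlib

/- STATEMENT 6: bound for the perturbing potential along the unperturbed
homoclinic: `|U(r_h(v), ξ)| ≤ K G⁻⁴ (1 + v²)⁻¹`. -/

open Real

/-- The inverse of Kepler's equation `u ↦ u - sin u`. -/
noncomputable def keplerE : ℝ → ℝ := Function.invFun (fun u : ℝ => u - Real.sin u)

/-- The regularized degenerate Keplerian collision orbit of the primaries. -/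
noncomputable def primRho (t : ℝ) : ℝ := 1 - Real.cos (keplerE t)

/-- The scaled perturbing potential `U(r̃,θ) = 1/r̃ − (r̃² + ρ(θ)²/(4G⁴))^{−1/2}`. -/
noncomputable def Upert (G rt θ : ℝ) : ℝ :=
  1 / rt - (rt ^ 2 + primRho θ ^ 2 / (4 * G ^ 4)) ^ (-(1 : ℝ) / 2)

/-- The inverse of the strictly increasing bijection `τ ↦ (τ + τ³/3)/2`. -/
noncomputable def tauOf : ℝ → ℝ := Function.invFun (fun τ : ℝ => (τ + τ ^ 3 / 3) / 2)

/-- The radial component of the unperturbed parabolic homoclinic orbit. -/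
noncomputable def rh (v : ℝ) : ℝ := (1 + tauOf v ^ 2) / 2

lemma tauOf_spec (v : ℝ) : (tauOf v + tauOf v ^ 3 / 3) / 2 = v := by
  have h : ∃ τ : ℝ, (fun τ : ℝ => (τ + τ ^ 3 / 3) / 2) τ = v := by
    have hc : Continuous (fun τ : ℝ => (τ + τ ^ 3 / 3) / 2) := by fun_prop
    have hp : 0 ≤ |v| ^ 3 := by positivity
    refine mem_range_of_exists_le_of_exists_ge hc ⟨-(2 * |v|), ?_⟩ ⟨2 * |v|, ?_⟩
    · have := neg_abs_le v
      nlinarith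
    · have := le_abs_self v
      nlinarith
  exact Function.invFun_eq h

lemma aux_bound (r a : ℝ) (hr : 0 < r) (ha : 0 ≤ a) :
    |1 / r - (r ^ 2 + a) ^ (-(1 : ℝ) / 2)| ≤ a / (2 * r ^ 3) := by
  have h0 : 0 ≤ r ^ 2 + a := by positivity
  have e : (r ^ 2 + a) ^ (-(1 : ℝ) / 2) = 1 / Real.sqrt (r ^ 2 + a) := by
    rw [neg_div, Real.rpow_neg h0, Real.sqrt_eq_rpow, one_div ((r ^ 2 + a) ^ _)]
  rw [e]
  have hs : Real.sqrt (r ^ 2 + a) ^ 2 = r ^ 2 + a := Real.sq_sqrt h0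
  have hrs : r ≤ Real.sqrt (r ^ 2 + a) := Real.le_sqrt_of_sq_le (by linarith)
  set s := Real.sqrt (r ^ 2 + a)
  have hs0 : 0 < s := by linarith
  have ea : a = (s - r) * (s + r) := by linarith
  have hd : 0 ≤ s - r := by linarith
  have e2 : 1 / r - 1 / s = (s - r) / (r * s) := by field_simp
  rw [e2, abs_of_nonneg (by positivity), ea, div_le_div_iff₀ (by positivity) (by positivity)]
  have h1 : 2 * r ^ 3 ≤ (s + r) * (r * s) := by
    calc 2 * r ^ 3 = (r + r) * (r * r) := by ring
      _ ≤ (s + r) * (r * s) := by gcongr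
  calc (s - r) * (2 * r ^ 3) ≤ (s - r) * ((s + r) * (r * s)) := by gcongr
    _ = _ := by ring

theorem potential_bound_along_homoclinic :
    ∃ K : ℝ, 0 < K ∧ ∀ G : ℝ, 1 ≤ G → ∀ v ξ : ℝ,
      |Upert G (rh v) ξ| ≤ K * (G ^ 4)⁻¹ * (1 + v ^ 2)⁻¹ := by
  refine ⟨5, by norm_num, fun G hG v ξ => ?_⟩
  have hG0 : 0 < G := by linarith
  have hr : 0 < rh v := by unfold rh; positivity
  have hv : 1 + v ^ 2 ≤ 10 * rh v ^ 3 := by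
    have h := tauOf_spec v
    unfold rh
    set τ := tauOf v
    rw [← h]
    have := sq_nonneg τ
    have := sq_nonneg (τ ^ 2)
    have := sq_nonneg (τ ^ 3)
    nlinarith
  have hρ0 : 0 ≤ primRho ξ := by
    unfold primRho; linarith [Real.cos_le_one (keplerE ξ)]
  have hρ2 : primRho ξ ≤ 2 := by
    unfold primRho; linarith [Real.neg_one_le_cos (keplerE ξ)]
  have hρ : primRho ξ ^ 2 ≤ 4 := by nlinarith
  have ha : primRho ξ ^ 2 / (4 * G ^ 4) ≤ (G ^ 4)⁻¹ := by
    rw [div_le_iff₀ (by positivity)]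
    have : (G ^ 4)⁻¹ * (4 * G ^ 4) = 4 := by field_simp
    linarith
  have hb := aux_bound (rh v) (primRho ξ ^ 2 / (4 * G ^ 4)) hr (by positivity)
  unfold Upert
  refine hb.trans ?_
  have h2 : (2 * rh v ^ 3)⁻¹ ≤ 5 * (1 + v ^ 2)⁻¹ := by
    rw [← div_eq_mul_inv, inv_eq_one_div, div_le_div_iff₀ (by positivity) (by positivity)]
    linarith
  rw [div_eq_mul_inv]
  calc _ ≤ (G ^ 4)⁻¹ * (5 * (1 + v ^ 2)⁻¹) := by gcongr
    _ = _ := by ring
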